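/- Let $e_1=(1,0,0)^\top\in\mathbb{R}^3$, let $R\in SO(3)$ (i.e. $R\in\mathbb{R}^{3\times 3}$, $R^\top R=I_3$, $\det R=1$), and let $Q=R^{-1}=R^\top$. For $p\in\mathbb{R}^3$ let $A(p)=3pp^\top-\|p\|^2I_3$, where $\|\cdot\|$ is the Euclidean norm, for $p\neq 0$ let $h(p)=\frac{1}{4\pi\|p\|^5}A(p)Re_1$ be the dipole magnetic field, and let $M=Q^\top e_1e_1^\top Q=Re_1e_1^\top R^\top$. Then for every $p\in\mathbb{R}^3$ with $p\neq 0$ the intensity of the dipole magnetic field satisfies $$\|h(p)\|=\frac{1}{4\pi\|p\|^3}\sqrt{1+3\,\frac{p^\top Mp}{\|p\|^2}}.$$ -/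

import Mathlib

open Matrix

namespace Dipole

noncomputable section

/-- `e₁ = (1,0,0)ᵀ`. -/
def e1 : Fin 3 → ℝ := ![1, 0, 0]

/-- `A(p) = 3 p pᵀ − ‖p‖² I₃`, with the Euclidean norm. -/
def A (p : EuclideanSpace ℝ (Fin 3)) : Matrix (Fin 3) (Fin 3) ℝ :=
  (3 : ℝ) • vecMulVec p p - ‖p‖ ^ 2 • (1 : Matrix (Fin 3) (Fin 3) ℝ)

/-- The dipole magnetic field `h(p) = (1/(4π‖p‖⁵)) A(p) R e₁`, in the coordinates of the frame in
which `p` is given; `R` is the rotation from the transmitter frame to that frame. Only meaningful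
for `p ≠ 0`. -/
def field (R : specialOrthogonalGroup (Fin 3) ℝ) (p : EuclideanSpace ℝ (Fin 3)) :
    EuclideanSpace ℝ (Fin 3) :=
  WithLp.toLp 2 ((1 / (4 * Real.pi * ‖p‖ ^ 5)) •
    (A p *ᵥ ((R : Matrix (Fin 3) (Fin 3) ℝ) *ᵥ e1)))

/-- `M = Qᵀ e₁ e₁ᵀ Q`, where `Q = R⁻¹` is the inverse rotation, from the frame in which `p` is
given to the transmitter frame. -/
def M (R : specialOrthogonalGroup (Fin 3) ℝ) : Matrix (Fin 3) (Fin 3) ℝ :=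
  ((R⁻¹ : specialOrthogonalGroup (Fin 3) ℝ) : Matrix (Fin 3) (Fin 3) ℝ)ᵀ * vecMulVec e1 e1 *
    ((R⁻¹ : specialOrthogonalGroup (Fin 3) ℝ) : Matrix (Fin 3) (Fin 3) ℝ)

end

end Dipole

namespace Dipole

/-- The dipole axis `R e₁` in the frame in which positions are given. -/
noncomputable def axis (R : specialOrthogonalGroup (Fin 3) ℝ) : EuclideanSpace ℝ (Fin 3) :=
  WithLp.toLp 2 ((R : Matrix (Fin 3) (Fin 3) ℝ) *ᵥ e1)

theorem transpose_mul_self (R : specialOrthogonalGroup (Fin 3) ℝ) :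
    (R : Matrix (Fin 3) (Fin 3) ℝ)ᵀ * (R : Matrix (Fin 3) (Fin 3) ℝ) = 1 :=
  (mem_orthogonalGroup_iff' (Fin 3) ℝ).1 (mem_specialOrthogonalGroup_iff.1 R.2).1

theorem norm_axis (R : specialOrthogonalGroup (Fin 3) ℝ) : ‖axis R‖ = 1 := by
  have h : ‖axis R‖ ^ 2 = 1 := by
    rw [← real_inner_self_eq_norm_sq, EuclideanSpace.inner_eq_star_dotProduct, star_trivial]
    simp only [axis]
    rw [dotProduct_mulVec, ← mulVec_transpose, mulVec_mulVec, transpose_mul_self, one_mulVec]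
    simp [e1, dotProduct, Fin.sum_univ_three]
  exact (pow_eq_one_iff_of_nonneg (norm_nonneg _) two_ne_zero).1 h

theorem field_eq_smul (R : specialOrthogonalGroup (Fin 3) ℝ) (p : EuclideanSpace ℝ (Fin 3)) :
    field R p = (1 / (4 * Real.pi * ‖p‖ ^ 5)) •
      ((3 * inner ℝ p (axis R)) • p - ‖p‖ ^ 2 • axis R) := by
  have h : A p *ᵥ (axis R).ofLp =
      (3 * inner ℝ p (axis R)) • p.ofLp - ‖p‖ ^ 2 • (axis R).ofLp := by
    rw [A, sub_mulVec, smul_mulVec, smul_mulVec, one_mulVec, vecMulVec_mulVec, mul_smul,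
      EuclideanSpace.inner_eq_star_dotProduct, star_trivial, dotProduct_comm, op_smul_eq_smul]
  rw [field]
  exact congrArg (fun v => WithLp.toLp 2 ((1 / (4 * Real.pi * ‖p‖ ^ 5)) • v)) h

theorem dotProduct_M_mulVec (R : specialOrthogonalGroup (Fin 3) ℝ)
    (p : EuclideanSpace ℝ (Fin 3)) :
    p.ofLp ⬝ᵥ (M R *ᵥ p.ofLp) = inner ℝ p (axis R) ^ 2 := by
  have hinv : ((R⁻¹ : specialOrthogonalGroup (Fin 3) ℝ) : Matrix (Fin 3) (Fin 3) ℝ)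
      = (R : Matrix (Fin 3) (Fin 3) ℝ)ᵀ := rfl
  rw [M, hinv, transpose_transpose, mul_vecMulVec, vecMulVec_mul, vecMul_transpose,
    vecMulVec_mulVec, op_smul_eq_smul, dotProduct_smul, EuclideanSpace.inner_eq_star_dotProduct,
    star_trivial, dotProduct_comm p.ofLp, smul_eq_mul, ← sq, axis]

/-- The squared norm of `3⟪p, u⟫ p - ‖p‖² u` for a unit vector `u`. -/
theorem norm_sq_dipole {E : Type*} [NormedAddCommGroup E] [InnerProductSpace ℝ E] (p u : E)
    (hu : ‖u‖ = 1) :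
    ‖(3 * inner ℝ p u) • p - ‖p‖ ^ 2 • u‖ ^ 2 =
      ‖p‖ ^ 4 + 3 * inner ℝ p u ^ 2 * ‖p‖ ^ 2 := by
  rw [norm_sub_sq_real, norm_smul, norm_smul, real_inner_smul_left, real_inner_smul_right,
    mul_pow, mul_pow, Real.norm_eq_abs, Real.norm_eq_abs, sq_abs, sq_abs, hu]
  ring

end Dipole

theorem dipole_intensity_formula (R : Matrix.specialOrthogonalGroup (Fin 3) ℝ)
    (p : EuclideanSpace ℝ (Fin 3)) (hp : p ≠ 0) :
    ‖Dipole.field R p‖ =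
      1 / (4 * Real.pi * ‖p‖ ^ 3) *
        Real.sqrt (1 + 3 * ((p : Fin 3 → ℝ) ⬝ᵥ (Dipole.M R *ᵥ (p : Fin 3 → ℝ))) / ‖p‖ ^ 2) := by
  have hn : 0 < ‖p‖ := norm_pos_iff.2 hp
  have hpi := Real.pi_pos
  rw [Dipole.dotProduct_M_mulVec, Dipole.field_eq_smul, norm_smul,
    Real.norm_of_nonneg (by positivity)]
  have key : ‖(3 * inner ℝ p (Dipole.axis R)) • p - ‖p‖ ^ 2 • Dipole.axis R‖ =
      ‖p‖ ^ 2 * Real.sqrt (1 + 3 * inner ℝ p (Dipole.axis R) ^ 2 / ‖p‖ ^ 2) := by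
    rw [← sq_eq_sq₀ (norm_nonneg _) (by positivity),
      Dipole.norm_sq_dipole _ _ (Dipole.norm_axis R), mul_pow, Real.sq_sqrt (by positivity)]
    field_simp
  rw [key]
  field_simp
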